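/- Let X be an ANR space that is Hausdorff, non-compact, σ-compact and locally compact. Then pTC(X) = 0 if and only if X is properly homotopy equivalent to the half-line [0,∞). -/

import Mathlib

open Set unitInterval
open scoped NNReal ENNReal

noncomputable section

universe u v

/-- A proper homotopy between two maps: a continuous map `H : X × [0,1] → Y` which is itself
proper, restricting to `f` at time `0` and to `g` at time `1`. -/
def ProperlyHomotopic {X : Type*} {Y : Type*} [TopologicalSpace X] [TopologicalSpace Y]
    (f g : X → Y) : Prop :=
  ∃ H : X × unitInterval → Y, IsProperMap H ∧
    (∀ x, H (x, 0) = f x) ∧ (∀ x, H (x, 1) = g x)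

/-- An ordinary (unbundled) homotopy between two maps. -/
def Homotopic' {X : Type*} {Y : Type*} [TopologicalSpace X] [TopologicalSpace Y]
    (f g : X → Y) : Prop :=
  ∃ H : X × unitInterval → Y, Continuous H ∧
    (∀ x, H (x, 0) = f x) ∧ (∀ x, H (x, 1) = g x)

/-- A proper homotopy equivalence: a proper map admitting a proper homotopy inverse. -/
def IsProperHomotopyEquiv {X : Type*} {Y : Type*} [TopologicalSpace X] [TopologicalSpace Y]
    (f : X → Y) : Prop :=
  IsProperMap f ∧ ∃ g : Y → X, IsProperMap g ∧
    ProperlyHomotopic (g ∘ f) (id : X → X) ∧ ProperlyHomotopic (f ∘ g) (id : Y → Y)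

/-- `PSecatLE f n`: the proper sectional category of the proper map `f` is at most `n`, i.e.
`Y` admits an open cover by `n + 1` sets, each of whose closures carries a proper map to `X`
whose composition with `f` is properly homotopic to the inclusion. -/
def PSecatLE {X : Type*} {Y : Type*} [TopologicalSpace X] [TopologicalSpace Y]
    (f : X → Y) (n : ℕ) : Prop :=
  ∃ U : Fin (n + 1) → Set Y, (∀ i, IsOpen (U i)) ∧ (⋃ i, U i) = Set.univ ∧
    ∀ i, ∃ s : closure (U i) → X, IsProperMap s ∧
      ProperlyHomotopic (fun y => f (s y)) (fun y : closure (U i) => (y : Y))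

/-- The proper sectional category of a proper map, with value in `ℕ∞`. -/
def pSecat {X : Type*} {Y : Type*} [TopologicalSpace X] [TopologicalSpace Y]
    (f : X → Y) : ℕ∞ :=
  sInf {n : ℕ∞ | ∃ m : ℕ, n = (m : ℕ∞) ∧ PSecatLE f m}

/-- `SecatLE f n`: the (classical) sectional category of `f` is at most `n`. -/
def SecatLE {X : Type*} {Y : Type*} [TopologicalSpace X] [TopologicalSpace Y]
    (f : X → Y) (n : ℕ) : Prop :=
  ∃ U : Fin (n + 1) → Set Y, (∀ i, IsOpen (U i)) ∧ (⋃ i, U i) = Set.univ ∧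
    ∀ i, ∃ s : U i → X, Continuous s ∧
      Homotopic' (fun y => f (s y)) (fun y : U i => (y : Y))

/-- The classical sectional category of a continuous map, with value in `ℕ∞`. -/
def secat {X : Type*} {Y : Type*} [TopologicalSpace X] [TopologicalSpace Y]
    (f : X → Y) : ℕ∞ :=
  sInf {n : ℕ∞ | ∃ m : ℕ, n = (m : ℕ∞) ∧ SecatLE f m}

/-- `PCatLE α n`: the `α`-proper Lusternik–Schnirelmann category of `X` is at most `n`.
Here `ℝ≥0 = [0,∞)` and `α : [0,∞) → X` is a ray. -/
def PCatLE {X : Type*} [TopologicalSpace X] (α : ℝ≥0 → X) (n : ℕ) : Prop :=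
  ∃ U : Fin (n + 1) → Set X, (∀ i, IsOpen (U i)) ∧ (⋃ i, U i) = Set.univ ∧
    ∀ i, ∃ r : closure (U i) → ℝ≥0, IsProperMap r ∧
      ProperlyHomotopic (fun x : closure (U i) => (x : X)) (fun x => α (r x))

/-- The `α`-proper Lusternik–Schnirelmann category, with value in `ℕ∞`. -/
def pCat {X : Type*} [TopologicalSpace X] (α : ℝ≥0 → X) : ℕ∞ :=
  sInf {n : ℕ∞ | ∃ m : ℕ, n = (m : ℕ∞) ∧ PCatLE α m}

/-- `LSCatLE X n`: the Lusternik–Schnirelmann category of `X` is at most `n`, i.e. `X` admits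
an open cover by `n + 1` sets whose inclusions are nullhomotopic. -/
def LSCatLE (X : Type*) [TopologicalSpace X] (n : ℕ) : Prop :=
  ∃ U : Fin (n + 1) → Set X, (∀ i, IsOpen (U i)) ∧ (⋃ i, U i) = Set.univ ∧
    ∀ i, ∃ x₀ : X, Homotopic' (fun x : U i => (x : X)) (fun _ => x₀)

/-- The Lusternik–Schnirelmann category, with value in `ℕ∞`. -/
def lsCat (X : Type*) [TopologicalSpace X] : ℕ∞ :=
  sInf {n : ℕ∞ | ∃ m : ℕ, n = (m : ℕ∞) ∧ LSCatLE X m}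

/-- `TCLE X n`: the topological complexity of `X` is at most `n`: there is an open cover
`U_0, …, U_n` of `X × X` with continuous local sections of the path fibration. -/
def TCLE (X : Type*) [TopologicalSpace X] (n : ℕ) : Prop :=
  ∃ U : Fin (n + 1) → Set (X × X), (∀ i, IsOpen (U i)) ∧ (⋃ i, U i) = Set.univ ∧
    ∀ i, ∃ s : U i → C(unitInterval, X), Continuous s ∧
      ∀ p : U i, s p 0 = (p : X × X).1 ∧ s p 1 = (p : X × X).2

/-- The topological complexity of `X`, with value in `ℕ∞`. -/
def TC' (X : Type*) [TopologicalSpace X] : ℕ∞ :=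
  sInf {n : ℕ∞ | ∃ m : ℕ, n = (m : ℕ∞) ∧ TCLE X m}

/-- `PTCLE X n`: the proper topological complexity of `X` is at most `n`: there is an open
cover `U_0, …, U_n` of `X × X` with continuous local sections `s_i` of the path fibration such
that every compact `K ⊆ X` is contained in a compact `L` with `s_i (x, y) t ∉ K` whenever
`(x, y) ∈ U_i`, `x ∉ L` and `y ∉ L`. -/
def PTCLE (X : Type*) [TopologicalSpace X] (n : ℕ) : Prop :=
  ∃ U : Fin (n + 1) → Set (X × X), (∀ i, IsOpen (U i)) ∧ (⋃ i, U i) = Set.univ ∧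
    ∃ s : (i : Fin (n + 1)) → U i → C(unitInterval, X),
      (∀ i, Continuous (s i)) ∧
      (∀ i (p : U i), s i p 0 = (p : X × X).1 ∧ s i p 1 = (p : X × X).2) ∧
      (∀ K : Set X, IsCompact K → ∃ L : Set X, IsCompact L ∧ K ⊆ L ∧
        ∀ i (p : U i), (p : X × X).1 ∉ L → (p : X × X).2 ∉ L →
          ∀ t : unitInterval, s i p t ∉ K)

/-- The proper topological complexity of `X`, with value in `ℕ∞`. -/
def pTC (X : Type*) [TopologicalSpace X] : ℕ∞ :=
  sInf {n : ℕ∞ | ∃ m : ℕ, n = (m : ℕ∞) ∧ PTCLE X m}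

/-- An ANR: a metrizable space which, whenever embedded as a closed subspace of a metrizable
space, is a retract of an open neighborhood. -/
def IsANR (X : Type u) [TopologicalSpace X] : Prop :=
  TopologicalSpace.MetrizableSpace X ∧
  ∀ (Z : Type u) [TopologicalSpace Z], TopologicalSpace.MetrizableSpace Z →
    ∀ e : X → Z, Topology.IsClosedEmbedding e →
      ∃ U : Set Z, IsOpen U ∧ Set.range e ⊆ U ∧
        ∃ r : U → X, Continuous r ∧ ∀ (x : X) (h : e x ∈ U), r ⟨e x, h⟩ = x

/-- The wedge `X ∨ Y` of two pointed spaces: the quotient of `X ⊕ Y` identifying the two base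
points. -/
abbrev Wedge (X Y : Type*) [TopologicalSpace X] [TopologicalSpace Y] (x₀ : X) (y₀ : Y) :=
  Quot (fun a b : X ⊕ Y => a = Sum.inl x₀ ∧ b = Sum.inr y₀)


/-- Any two proper maps into `[0, ∞)` are properly homotopic. -/
theorem properlyHomotopic_nnreal {X : Type*} [TopologicalSpace X] {a b : X → ℝ≥0}
    (ha : IsProperMap a) (hb : IsProperMap b) : ProperlyHomotopic a b := by
  refine ⟨fun p => Real.toNNReal ((1 - (p.2 : ℝ)) * a p.1 + p.2 * b p.1), ?_, ?_, ?_⟩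
  · have hac := ha.continuous
    have hbc := hb.continuous
    have hc : Continuous fun p : X × unitInterval =>
        Real.toNNReal ((1 - (p.2 : ℝ)) * a p.1 + p.2 * b p.1) := by fun_prop
    refine isProperMap_iff_isCompact_preimage.2 ⟨hc, fun K hK => ?_⟩
    obtain ⟨M, hM⟩ := hK.bddAbove
    have hI : IsCompact (Iic M) := by
      rw [← Icc_bot]
      exact isCompact_Icc
    refine (((ha.isCompact_preimage hI).union (hb.isCompact_preimage hI)).prod
      (isCompact_univ (X := unitInterval))).of_isClosed_subset (hK.isClosed.preimage hc) ?_
    rintro ⟨x, t⟩ hx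
    refine ⟨?_, mem_univ _⟩
    by_contra! h
    simp only [mem_union, mem_preimage, mem_Iic, not_or, not_le] at h
    have h1 := Real.toNNReal_le_iff_le_coe.1 (hM hx)
    have h2 : (M : ℝ) < a x := h.1
    have h3 : (M : ℝ) < b x := h.2
    have h4 := t.2.1
    have h5 := t.2.2
    dsimp only at h1
    rcases h4.eq_or_lt with h0 | h0
    · rw [← h0] at h1
      linarith
    · nlinarith [mul_pos h0 (sub_pos.2 h3), mul_nonneg (sub_nonneg.2 h5) (sub_pos.2 h2).le]
  · intro x
    simp
  · intro x
    simp

theorem ProperlyHomotopic.symm {X Y : Type*} [TopologicalSpace X] [TopologicalSpace Y]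
    {f g : X → Y} (h : ProperlyHomotopic f g) : ProperlyHomotopic g f := by
  obtain ⟨H, hH, h0, h1⟩ := h
  refine ⟨fun p => H (p.1, unitInterval.symm p.2), ?_, fun x => by simp [h1],
    fun x => by simp [h0]⟩
  exact hH.comp (((Homeomorph.refl X).prodCongr unitInterval.symmHomeomorph).isProperMap)

/-- A σ-compact locally compact Hausdorff space admits a proper map to the half-line. -/
theorem exists_isProperMap_nnreal (X : Type*) [TopologicalSpace X] [T2Space X]
    [SigmaCompactSpace X] [LocallyCompactSpace X] : ∃ r : X → ℝ≥0, IsProperMap r := by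
  let K : CompactExhaustion X := default
  obtain ⟨g, hg⟩ := exists_continuous_forall_mem_convex_of_local_const
    (t := fun x : X => Ici (K.find x : ℝ)) (fun x => convex_Ici _) (fun x => by
      refine ⟨((K.find x + 1 : ℕ) : ℝ), ?_⟩
      filter_upwards [mem_interior_iff_mem_nhds.1
        (K.subset_interior_succ _ (K.mem_find x))] with y hy
      exact Nat.cast_le (α := ℝ).2 (K.mem_iff_find_le.1 hy))
  have hc : Continuous fun x => Real.toNNReal (g x) := by fun_prop
  refine ⟨_, isProperMap_iff_isCompact_preimage.2 ⟨hc, fun C hC => ?_⟩⟩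
  obtain ⟨M, hM⟩ := hC.bddAbove
  obtain ⟨n, hn⟩ := exists_nat_ge (M : ℝ)
  refine (K.isCompact n).of_isClosed_subset (hC.isClosed.preimage hc) fun x hx => ?_
  have h1 := Real.toNNReal_le_iff_le_coe.1 (hM hx)
  have h2 : (K.find x : ℝ) ≤ g x := hg x
  exact K.mem_iff_find_le.2 (Nat.cast_le.1 ((h2.trans h1).trans hn))

/-- Infinite concatenation of paths joining consecutive points of a sequence. -/
theorem exists_continuous_ray {X : Type*} [TopologicalSpace X] (x : ℕ → X)
    (γ : ℕ → C(unitInterval, X)) (h0 : ∀ n, γ n 0 = x n) (h1 : ∀ n, γ n 1 = x (n + 1)) :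
    ∃ α : ℝ≥0 → X, Continuous α ∧ ∀ t, α t ∈ range (γ ⌊t⌋₊) := by
  let β : ℕ → ℝ≥0 → X := fun n t => γ n (projIcc (0 : ℝ) 1 zero_le_one ((t : ℝ) - n))
  have hβ (n : ℕ) : Continuous (β n) := by
    have := continuous_projIcc (a := (0 : ℝ)) (b := 1) (h := zero_le_one)
    fun_prop
  refine ⟨fun t => β ⌊t⌋₊ t, ?_, fun t => ⟨_, rfl⟩⟩
  refine LocallyFinite.continuous (f := fun n : ℕ => Icc (n : ℝ≥0) (n + 1)) ?_ ?_
    (fun _ => isClosed_Icc) fun n => ?_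
  · intro t
    refine ⟨Iio (t + 1), Iio_mem_nhds (by simp), ?_⟩
    obtain ⟨N, hN⟩ := exists_nat_ge (t + 1)
    refine (finite_Iio N).subset ?_
    rintro n ⟨y, hy, hyt⟩
    exact Nat.cast_lt.1 ((hy.1.trans_lt hyt).trans_le hN)
  · refine eq_univ_of_forall fun t => mem_iUnion.2 ⟨⌊t⌋₊, Nat.floor_le t.2, ?_⟩
    exact (Nat.lt_floor_add_one t).le
  · refine (hβ n).continuousOn.congr fun t ht => ?_
    rcases ht.2.eq_or_lt with h | h
    · have hf : ⌊t⌋₊ = n + 1 := by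
        rw [h]
        exact_mod_cast Nat.floor_natCast (R := ℝ≥0) (n + 1)
      simp only [β, hf]
      rw [h]
      simp [projIcc_left, projIcc_right, h0, h1]
    · have hf : ⌊t⌋₊ = n := (Nat.floor_eq_iff t.2).2 ⟨ht.1, h⟩
      simp only [hf]

theorem pTC_eq_zero_iff_PTCLE_zero (X : Type*) [TopologicalSpace X] :
    pTC X = 0 ↔ PTCLE X 0 := by
  constructor
  · intro h
    have hne : {n : ℕ∞ | ∃ m : ℕ, n = (m : ℕ∞) ∧ PTCLE X m}.Nonempty := by
      by_contra hne
      rw [not_nonempty_iff_eq_empty] at hne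
      simp [pTC, hne] at h
    obtain ⟨m, hm, hX⟩ := csInf_mem hne
    rw [show sInf {n : ℕ∞ | ∃ m : ℕ, n = (m : ℕ∞) ∧ PTCLE X m} = 0 from h] at hm
    obtain rfl : m = 0 := by exact_mod_cast hm.symm
    exact hX
  · intro h
    exact le_antisymm (sInf_le ⟨0, rfl, h⟩) zero_le

/-- `PTCLE X 0` amounts to a global motion planner that avoids compact sets whenever its
endpoints are far out. -/
theorem PTCLE_zero_iff (X : Type*) [TopologicalSpace X] :
    PTCLE X 0 ↔ ∃ s : X × X → C(unitInterval, X), Continuous s ∧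
      (∀ p, s p 0 = p.1 ∧ s p 1 = p.2) ∧
      ∀ K : Set X, IsCompact K → ∃ L : Set X, IsCompact L ∧ K ⊆ L ∧
        ∀ p, p.1 ∉ L → p.2 ∉ L → ∀ t, s p t ∉ K := by
  constructor
  · rintro ⟨U, -, hU, s, hs, he, hK⟩
    have hm (p : X × X) : p ∈ U 0 := by
      obtain ⟨i, hi⟩ := mem_iUnion.1 (hU ▸ mem_univ p)
      rwa [Fin.fin_one_eq_zero i] at hi
    refine ⟨fun p => s 0 ⟨p, hm p⟩, (hs 0).comp (by fun_prop), fun p => he 0 _, fun K h => ?_⟩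
    obtain ⟨L, hL, hKL, h'⟩ := hK K h
    exact ⟨L, hL, hKL, fun p h1 h2 => h' 0 ⟨p, hm p⟩ h1 h2⟩
  · rintro ⟨s, hs, he, hK⟩
    refine ⟨fun _ => univ, fun _ => isOpen_univ, iUnion_const _, fun _ p => s p,
      fun _ => hs.comp continuous_subtype_val, fun _ p => he p, fun K h => ?_⟩
    obtain ⟨L, hL, hKL, h'⟩ := hK K h
    exact ⟨L, hL, hKL, fun _ p h1 h2 => h' p h1 h2⟩

theorem exists_isProperHomotopyEquiv_of_PTCLE_zero {X : Type*} [TopologicalSpace X]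
    [T2Space X] [NoncompactSpace X] [SigmaCompactSpace X] [LocallyCompactSpace X]
    (h : PTCLE X 0) : ∃ f : X → ℝ≥0, IsProperHomotopyEquiv f := by
  obtain ⟨s, hs, he, hK⟩ := (PTCLE_zero_iff X).1 h
  let K : CompactExhaustion X := default
  choose L hLc hKL hL using fun n => hK (K n) (K.isCompact n)
  have hx (n : ℕ) : ∃ x : X, ∀ m ≤ n, x ∉ L m := by
    have hc : IsCompact (⋃ m ∈ Iic n, L m) := (finite_Iic n).isCompact_biUnion fun m _ => hLc m
    obtain ⟨x, hx⟩ := (ne_univ_iff_exists_notMem _).1 hc.ne_univ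
    exact ⟨x, by simpa using hx⟩
  choose x hx using hx
  obtain ⟨α, hα, hαr⟩ := exists_continuous_ray x (fun n => s (x n, x (n + 1)))
    (fun n => (he _).1) (fun n => (he _).2)
  have hαp : IsProperMap α := by
    refine isProperMap_iff_isCompact_preimage.2 ⟨hα, fun C hC => ?_⟩
    obtain ⟨n, hn⟩ := K.exists_superset_of_isCompact hC
    refine (isCompact_Icc (a := (0 : ℝ≥0)) (b := n)).of_isClosed_subset
      (hC.isClosed.preimage hα) fun t ht => ⟨t.2, ?_⟩
    by_contra! hlt
    have hnt : n ≤ ⌊t⌋₊ := Nat.le_floor hlt.le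
    obtain ⟨u, hu⟩ := hαr t
    refine hL n (x ⌊t⌋₊, x (⌊t⌋₊ + 1)) (hx _ n hnt) (hx _ n (hnt.trans (Nat.le_succ _))) u (hn ?_)
    rw [hu]
    exact ht
  obtain ⟨r, hr⟩ := exists_isProperMap_nnreal X
  refine ⟨r, hr, α, hαp, ProperlyHomotopic.symm ?_,
    properlyHomotopic_nnreal (hr.comp hαp) isProperMap_id⟩
  have hc : Continuous fun p : X × unitInterval => s (p.1, α (r p.1)) p.2 := by
    have := hr.continuous
    fun_prop
  refine ⟨fun p => s (p.1, α (r p.1)) p.2, isProperMap_iff_isCompact_preimage.2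
    ⟨hc, fun C hC => ?_⟩, fun y => (he _).1, fun y => (he _).2⟩
  obtain ⟨L', hL', -, h'⟩ := hK C hC
  refine ((hL'.union ((hαp.comp hr).isCompact_preimage hL')).prod
    (isCompact_univ (X := unitInterval))).of_isClosed_subset (hC.isClosed.preimage hc) ?_
  rintro ⟨y, t⟩ hy
  refine ⟨?_, mem_univ _⟩
  by_contra hn
  rw [mem_union, not_or] at hn
  exact h' (y, α (r y)) hn.1 hn.2 t hy

theorem PTCLE_zero_of_isProperHomotopyEquiv {X : Type*} [TopologicalSpace X]
    {f : X → ℝ≥0} (h : IsProperHomotopyEquiv f) : PTCLE X 0 := by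
  obtain ⟨hf, α, hα, ⟨H, hH, H0, H1⟩, -⟩ := h
  have hfc := hf.continuous
  have hαc := hα.continuous
  have hHc := hH.continuous
  let c : ℝ → unitInterval := projIcc 0 1 zero_le_one
  have hc : Continuous c := continuous_projIcc
  have hc0 : c 0 = 0 := projIcc_left _
  have hc1 : c 1 = 1 := projIcc_right _
  let A : (X × X) × unitInterval → X := fun q => H (q.1.1, c (1 - 3 * q.2))
  let m : (X × X) × unitInterval → ℝ := fun q =>
    (1 - (c (3 * q.2 - 1) : ℝ)) * f q.1.1 + c (3 * q.2 - 1) * f q.1.2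
  let B : (X × X) × unitInterval → X := fun q => α (m q).toNNReal
  let C : (X × X) × unitInterval → X := fun q => H (q.1.2, c (3 * q.2 - 2))
  have hA : Continuous A := by fun_prop
  have hB : Continuous B := by fun_prop
  have hC : Continuous C := by fun_prop
  let F : (X × X) × unitInterval → X := fun q =>
    if (q.2 : ℝ) ≤ 1 / 3 then A q else if (q.2 : ℝ) ≤ 2 / 3 then B q else C q
  have hF : Continuous F := by
    refine hA.if_le (hB.if_le hC (by fun_prop) continuous_const fun q hq => ?_)
      (by fun_prop) continuous_const fun q hq => ?_
    · simp only [B, C, m]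
      norm_num [hq, hc0, hc1, H0]
    · norm_num [A, B, m, hq, hc0, H0]
  refine (PTCLE_zero_iff X).2 ⟨fun p => (ContinuousMap.mk F hF).curry p,
    (ContinuousMap.mk F hF).curry.continuous, fun p => ⟨?_, ?_⟩, fun K hK => ?_⟩
  · simp [F, A, hc1, H1]
  · norm_num [F, C, hc1, H1]
  · obtain ⟨M, hM⟩ := (hα.isCompact_preimage hK).bddAbove
    refine ⟨K ∪ Prod.fst '' (H ⁻¹' K) ∪ f ⁻¹' (Icc 0 M),
      (hK.union ((hH.isCompact_preimage hK).image continuous_fst)).union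
        (hf.isCompact_preimage isCompact_Icc),
      fun y hy => .inl (.inl hy), ?_⟩
    rintro ⟨y, z⟩ hy hz t ht
    have key (w : X) (hw : w ∉ K ∪ Prod.fst '' (H ⁻¹' K) ∪ f ⁻¹' (Icc 0 M)) :
        (∀ u, H (w, u) ∉ K) ∧ (M : ℝ) < f w := by
      refine ⟨fun u hu => hw (.inl (.inr ⟨(w, u), hu, rfl⟩)), ?_⟩
      by_contra! hle
      exact hw (.inr ⟨zero_le, hle⟩)
    obtain ⟨hy1, hy2⟩ := key y hy
    obtain ⟨hz1, hz2⟩ := key z hz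
    change F ((y, z), t) ∈ K at ht
    simp only [F] at ht
    split_ifs at ht
    · exact hy1 _ ht
    · have h1 : m ((y, z), t) ≤ M := Real.toNNReal_le_iff_le_coe.1 (hM ht)
      simp only [m] at h1
      obtain ⟨h4, h5⟩ := (c (3 * (t : ℝ) - 1)).2
      rcases h4.eq_or_lt with h0 | h0
      · rw [← h0] at h1
        linarith
      · nlinarith [mul_pos h0 (sub_pos.2 hz2), mul_nonneg (sub_nonneg.2 h5) (sub_pos.2 hy2).le]
    · exact hz1 _ ht

/-- For a Hausdorff, non-compact, σ-compact, locally compact ANR space `X`, `pTC X = 0` if and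
only if `X` is properly homotopy equivalent to the half-line `[0, ∞)`. -/
theorem pTC_eq_zero_iff {X : Type u} [TopologicalSpace X]
    [T2Space X] [NoncompactSpace X] [SigmaCompactSpace X] [LocallyCompactSpace X]
    (hX : IsANR X) :
    pTC X = 0 ↔ ∃ f : X → ℝ≥0, IsProperHomotopyEquiv f := by
  rw [pTC_eq_zero_iff_PTCLE_zero]
  exact ⟨exists_isProperHomotopyEquiv_of_PTCLE_zero,
    fun ⟨_, hf⟩ => PTCLE_zero_of_isProperHomotopyEquiv hf⟩

end
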